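/- Let G be a finite abelian group such that for every sequence S over G with |S| ≥ D(G) − 1, the set E(S) contains no non-trivial subgroup of G. Then every sequence S over G with 0 not a term of S, |S| ≥ D(G) − 1, and N_0(S) = 2^{|S|−D(G)+1} satisfies |S| ≤ D(G) + |G| − 1. -/

import Mathlib

/-- `NSub S g` is the number of subsequences (sub-multisets, counted with the
multiplicity of their appearance in `S`) of the sequence `S` with sum `g`. -/
def NSub {G : Type*} [AddCommGroup G] [DecidableEq G] (S : Multiset G) (g : G) : ℕ :=
  (S.powerset.filter (fun T => T.sum = g)).card

/-- The Davenport constant of `G`: the smallest positive integer `ℓ` such that every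
sequence over `G` of length at least `ℓ` has a nonempty zero-sum subsequence. -/
noncomputable def Davenport (G : Type*) [AddCommGroup G] : ℕ :=
  sInf {ℓ : ℕ | 0 < ℓ ∧ ∀ S : Multiset G, ℓ ≤ Multiset.card S →
    ∃ T : Multiset G, T ≤ S ∧ T ≠ 0 ∧ T.sum = 0}

/-- `ESet S = {g ∈ G : N_g(S) = 2 ^ (|S| - D(G) + 1)}`. -/
def ESet {G : Type*} [AddCommGroup G] [DecidableEq G] (S : Multiset G) : Set G :=
  {g | NSub S g = 2 ^ (Multiset.card S + 1 - Davenport G)}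

/-- A minimal zero-sum sequence: nonempty, zero-sum, and every nonempty proper
subsequence has nonzero sum. -/
def IsMinZeroSum {G : Type*} [AddCommGroup G] (T : Multiset G) : Prop :=
  T ≠ 0 ∧ T.sum = 0 ∧ ∀ U : Multiset G, U ≤ T → U ≠ 0 → U ≠ T → U.sum ≠ 0

section Helpers

variable {G : Type*} [AddCommGroup G] [DecidableEq G]

theorem NSub_pos_iff (S : Multiset G) (g : G) :
    0 < NSub S g ↔ ∃ T ≤ S, T.sum = g := by
  simp [NSub, Multiset.card_pos_iff_exists_mem]

theorem NSub_cons (a : G) (S : Multiset G) (g : G) :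
    NSub (a ::ₘ S) g = NSub S g + NSub S (g - a) := by
  have h : ∀ T : Multiset G, a + T.sum = g ↔ T.sum = g - a := fun T => by
    rw [eq_sub_iff_add_eq, add_comm]
  simp [NSub, Multiset.filter_add, Multiset.filter_map, h]

/-- The finite set of all sums of (possibly empty) subsequences of `S`. -/
def subsums (S : Multiset G) : Finset G := (S.powerset.map Multiset.sum).toFinset

theorem mem_subsums {S : Multiset G} {x : G} : x ∈ subsums S ↔ ∃ T ≤ S, T.sum = x := by
  simp [subsums]

theorem subsums_mono {S T : Multiset G} (h : S ≤ T) : subsums S ⊆ subsums T := by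
  intro x hx
  obtain ⟨U, hU, rfl⟩ := mem_subsums.1 hx
  exact mem_subsums.2 ⟨U, hU.trans h, rfl⟩

theorem card_lt_card_subsums_or (W : Multiset G) :
    W.card + 1 ≤ (subsums W).card ∨
      ∃ w W', w ::ₘ W' ≤ W ∧ ∀ k : ℕ, k • w ∈ subsums W' := by
  induction W using Multiset.induction_on with
  | empty => left; simp [subsums]
  | cons a W ih =>
    rcases ih with h | ⟨w, W', hw, hk⟩
    · by_cases hs : subsums W = subsums (a ::ₘ W)
      · refine Or.inr ⟨a, W, le_rfl, fun k => ?_⟩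
        induction k with
        | zero => exact mem_subsums.2 ⟨0, zero_le, by simp⟩
        | succ k ihk =>
          obtain ⟨T, hT, hTs⟩ := mem_subsums.1 ihk
          rw [hs]
          exact mem_subsums.2 ⟨a ::ₘ T, Multiset.cons_le_cons a hT, by
            rw [Multiset.sum_cons, hTs, succ_nsmul, add_comm]⟩
      · left
        have := Finset.card_lt_card
          ((subsums_mono (Multiset.le_cons_self W a)).ssubset_of_ne hs)
        rw [Multiset.card_cons]
        omega
    · exact Or.inr ⟨w, W', hw.trans (Multiset.le_cons_self W a), hk⟩

variable [Fintype G]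

theorem exists_nsmul_mem_subsums {W : Multiset G} (hW : Fintype.card G ≤ W.card) :
    ∃ w W', w ::ₘ W' ≤ W ∧ ∀ k : ℕ, k • w ∈ subsums W' := by
  rcases card_lt_card_subsums_or W with h | h
  · have := Finset.card_le_univ (subsums W)
    omega
  · exact h

theorem Davenport_spec {G : Type*} [AddCommGroup G] [Fintype G] : 0 < Davenport G ∧ ∀ S : Multiset G, Davenport G ≤ S.card →
    ∃ T : Multiset G, T ≤ S ∧ T ≠ 0 ∧ T.sum = 0 := by
  classical
  refine Nat.sInf_mem (s := {ℓ : ℕ | 0 < ℓ ∧ ∀ S : Multiset G, ℓ ≤ Multiset.card S →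
    ∃ T : Multiset G, T ≤ S ∧ T ≠ 0 ∧ T.sum = 0}) ⟨Fintype.card G, Fintype.card_pos, ?_⟩
  intro S hS
  obtain ⟨w, W', hw, hk⟩ := exists_nsmul_mem_subsums hS
  obtain ⟨T, hT, hTs⟩ := mem_subsums.1 (hk (addOrderOf w - 1))
  refine ⟨w ::ₘ T, (Multiset.cons_le_cons w hT).trans hw, Multiset.cons_ne_zero, ?_⟩
  rw [Multiset.sum_cons, hTs, ← succ_nsmul', Nat.sub_add_cancel (addOrderOf_pos w),
    addOrderOf_nsmul_eq_zero]

/-- In a long sequence, some term lies in one but not in all of the subsequences with a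
given (attained) sum. -/
theorem exists_cons_NSub_pos {S : Multiset G} (hS : Davenport G ≤ S.card) {g : G}
    (hg : 0 < NSub S g) :
    ∃ h S', S = h ::ₘ S' ∧ 0 < NSub S' g ∧ 0 < NSub S' (g - h) := by
  obtain ⟨R, hR, rfl⟩ := (NSub_pos_iff S g).1 hg
  obtain ⟨Q, rfl⟩ := Multiset.le_iff_exists_add.1 hR
  obtain ⟨T, hT, hT0, hTs⟩ := Davenport_spec.2 (R.map Neg.neg + Q) (by simpa using hS)
  obtain ⟨A, hA, B, hB, rfl⟩ : ∃ A ≤ R, ∃ B ≤ Q, T = A.map Neg.neg + B := by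
    refine ⟨(T ∩ R.map Neg.neg).map Neg.neg, ?_, T - R.map Neg.neg, ?_, ?_⟩
    · have := Multiset.map_le_map (f := Neg.neg)
        (Multiset.inter_le_right (s := T) (t := R.map Neg.neg))
      simpa using this
    · exact tsub_le_iff_left.2 hT
    · ext x
      simp only [Multiset.map_map, Function.comp_def, neg_neg, Multiset.map_id',
        Multiset.count_add, Multiset.count_inter, Multiset.count_sub]
      omega
  obtain ⟨R, rfl⟩ := Multiset.le_iff_exists_add.1 hA
  obtain ⟨Q, rfl⟩ := Multiset.le_iff_exists_add.1 hB
  have hAB : B.sum = A.sum := by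
    rw [Multiset.sum_add, Multiset.sum_map_neg', neg_add_eq_zero] at hTs
    exact hTs.symm
  rcases A.empty_or_exists_mem with rfl | ⟨a, ha⟩
  · rcases B.empty_or_exists_mem with rfl | ⟨b, hb⟩
    · simp at hT0
    · obtain ⟨B, rfl⟩ := Multiset.exists_cons_of_mem hb
      refine ⟨b, R + (B + Q), by simp, (NSub_pos_iff _ _).2 ⟨R, by simp, by simp⟩,
        (NSub_pos_iff _ _).2 ⟨R + B, by simp [← add_assoc], ?_⟩⟩
      simp only [Multiset.sum_cons, Multiset.sum_zero] at hAB
      simp only [Multiset.sum_add, Multiset.sum_zero]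
      rw [eq_neg_of_add_eq_zero_right hAB]
      abel
  · obtain ⟨A, rfl⟩ := Multiset.exists_cons_of_mem ha
    refine ⟨a, A + R + (B + Q), by simp, (NSub_pos_iff _ _).2 ⟨R + B, ?_, ?_⟩,
      (NSub_pos_iff _ _).2 ⟨A + R, by simp, by simp⟩⟩
    · exact add_le_add (Multiset.le_add_left _ _) (Multiset.le_add_right _ _)
    · rw [Multiset.sum_add, Multiset.sum_add, hAB, add_comm]

theorem two_pow_le_NSub {S : Multiset G} {g : G} (hg : 0 < NSub S g) :
    2 ^ (S.card + 1 - Davenport G) ≤ NSub S g := by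
  induction hn : S.card generalizing S g with
  | zero =>
    have := (Davenport_spec (G := G)).1
    rwa [Nat.sub_eq_zero_of_le (by omega), pow_zero]
  | succ n ih =>
    by_cases hD : Davenport G ≤ n + 1
    · obtain ⟨h, S', rfl, h1, h2⟩ := exists_cons_NSub_pos (hn ▸ hD) hg
      rw [Multiset.card_cons, Nat.add_right_cancel_iff] at hn
      rw [NSub_cons, Nat.sub_add_comm hD, pow_succ, mul_two]
      exact add_le_add (ih h1 hn) (ih h2 hn)
    · rwa [Nat.sub_eq_zero_of_le (by omega), pow_zero]

/-- If all counts in `V` of negated subsums of `W` are minimal and `V` is long, then a term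
of `V` can be moved to `W`. -/
theorem exists_move {W V : Multiset G} (hV : Davenport G ≤ V.card)
    (h : ∀ U ≤ W, NSub V (-U.sum) = 2 ^ (V.card + 1 - Davenport G)) :
    ∃ g V', V = g ::ₘ V' ∧
      ∀ U ≤ g ::ₘ W, NSub V' (-U.sum) = 2 ^ (V'.card + 1 - Davenport G) := by
  have h0 := h 0 zero_le
  rw [Multiset.sum_zero, neg_zero] at h0
  obtain ⟨g, V, rfl, h1, h2⟩ := exists_cons_NSub_pos hV (g := 0) (h0 ▸ by positivity)
  refine ⟨g, V, rfl, ?_⟩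
  rw [Multiset.card_cons] at hV
  simp only [Multiset.card_cons, Nat.sub_add_comm hV, pow_succ, mul_two] at h
  have key : ∀ U ≤ W, NSub V (-U.sum) = 2 ^ (V.card + 1 - Davenport G) ∧
      NSub V (-U.sum - g) = 2 ^ (V.card + 1 - Davenport G) := by
    intro U
    induction U using Multiset.induction_on with
    | empty =>
      intro hU
      have e := h 0 hU
      rw [NSub_cons] at e
      simp only [Multiset.sum_zero, neg_zero] at e ⊢
      have := two_pow_le_NSub h1
      have := two_pow_le_NSub h2
      omega
    | cons w U ih =>
      intro hU
      have hU' := (Multiset.le_cons_self U w).trans hU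
      obtain ⟨i1, i2⟩ := ih hU'
      have e1 := h U hU'
      have e2 := h _ hU
      have p : 0 < 2 ^ (V.card + 1 - Davenport G) := by positivity
      have l1 := two_pow_le_NSub (S := w ::ₘ V) (g := -U.sum) (by rw [NSub_cons]; omega)
      have l2 := two_pow_le_NSub (S := w ::ₘ V) (g := -U.sum - g) (by rw [NSub_cons]; omega)
      rw [Multiset.card_cons, Nat.sub_add_comm hV, pow_succ, mul_two, NSub_cons] at l1 l2
      rw [NSub_cons] at e1 e2
      rw [Multiset.sum_cons, neg_add_rev, ← sub_eq_add_neg] at e2 ⊢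
      rw [sub_right_comm] at l2
      omega
  intro U hU
  by_cases hg : g ∈ U
  · obtain ⟨U, rfl⟩ := Multiset.exists_cons_of_mem hg
    rw [Multiset.sum_cons, neg_add_rev, ← sub_eq_add_neg]
    exact (key U ((Multiset.cons_le_cons_iff g).1 hU)).2
  · exact (key U ((Multiset.le_cons_of_notMem hg).1 hU)).1

theorem exists_split {S : Multiset G}
    (hS : NSub S 0 = 2 ^ (S.card + 1 - Davenport G)) (k : ℕ)
    (hk : k + Davenport G ≤ S.card + 1) :
    ∃ W V, S = W + V ∧ W.card = k ∧
      ∀ U ≤ W, NSub V (-U.sum) = 2 ^ (V.card + 1 - Davenport G) := by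
  induction k with
  | zero => exact ⟨0, S, by simp, rfl, fun U hU => by
      rw [Multiset.le_zero.1 hU, Multiset.sum_zero, neg_zero, hS]⟩
  | succ k ih =>
    obtain ⟨W, V, rfl, rfl, h⟩ := ih (by omega)
    rw [Multiset.card_add] at hk
    obtain ⟨g, V, rfl, h'⟩ := exists_move (by omega) h
    exact ⟨g ::ₘ W, V, by simp, by simp, h'⟩

end Helpers

theorem stmt14 {G : Type*} [AddCommGroup G] [Fintype G] [DecidableEq G]
    (hyp : ∀ S : Multiset G, Davenport G - 1 ≤ Multiset.card S →
      ∀ H : AddSubgroup G, H ≠ ⊥ → ¬ ((H : Set G) ⊆ ESet S)) :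
    ∀ S : Multiset G, (0 : G) ∉ S → Davenport G - 1 ≤ Multiset.card S →
      NSub S 0 = 2 ^ (Multiset.card S + 1 - Davenport G) →
      Multiset.card S ≤ Davenport G + Fintype.card G - 1 := by
  intro S hS0 _ hS
  by_contra! hlt
  obtain ⟨W, V, rfl, hW, h⟩ := exists_split hS (Fintype.card G) (by omega)
  obtain ⟨w, W', hw, hk⟩ := exists_nsmul_mem_subsums hW.ge
  have hwW : w ∈ W := Multiset.mem_of_le hw (Multiset.mem_cons_self w W')
  have hw0 : w ≠ 0 := by
    rintro rfl
    exact hS0 (Multiset.mem_add.2 (Or.inl hwW))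
  rw [Multiset.card_add] at hlt
  refine hyp V (by omega) (AddSubgroup.zmultiples w) (by simpa using hw0) fun x hx => ?_
  obtain ⟨k, hkx⟩ := (mem_multiples_iff_mem_zmultiples (x := w)).2 (neg_mem hx)
  obtain ⟨U, hU, hUs⟩ := mem_subsums.1 (hk k)
  have hUx : U.sum = -x := hUs.trans hkx
  have := h U (hU.trans ((Multiset.le_cons_self W' w).trans hw))
  rwa [hUx, neg_neg] at this
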